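/- If G is a unicyclic graph with n ≥ 4 vertices and α ∈ (0,1), then (n-1)^α + 2^{α+1} + n - 3 ≤ Σ_{u ∈ V(G)} d_u^α ≤ n·2^α, with the lower bound attained if and only if G = U_n^3 and the upper bound attained if and only if G = C_n. -/

import Mathlib

open Finset SimpleGraph

/-- A unicyclic graph: connected with as many edges as vertices. -/
def IsUnicyclic {n : ℕ} (G : SimpleGraph (Fin n)) [DecidableRel G.Adj] : Prop :=
  G.Connected ∧ G.edgeFinset.card = n

/-- The graph `U_n^3`: a triangle on vertices 0,1,2 with n-3 pendant edges attached to 0. -/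
def unicyclicStar (n : ℕ) : SimpleGraph (Fin n) :=
  SimpleGraph.fromRel (fun i j => i.val = 0 ∨ (i.val = 1 ∧ j.val = 2))

lemma exists_cycle_map {n : ℕ} (G : SimpleGraph (Fin n)) [DecidableRel G.Adj]
    (hG : IsUnicyclic G) : ∃ k : ℕ, ∃ f : Fin (k+3) → Fin n, Function.Injective f ∧
      ∀ i j, (cycleGraph (k+3)).Adj i j → G.Adj (f i) (f j) := by
  have h : ¬ G.IsAcyclic := by
    intro h
    have ht : G.IsTree := ⟨hG.1, h⟩
    have h1 := ht.card_edgeFinset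
    have h2 := hG.2
    simp only [Fintype.card_fin] at h1
    omega
  rw [isAcyclic_iff_free_cycleGraph] at h
  push Not at h
  obtain ⟨k, hk, hc⟩ := h
  obtain ⟨k, rfl⟩ := Nat.exists_eq_add_of_le' hk
  obtain ⟨f⟩ := hc
  exact ⟨k, f, f.injective, fun i j h => f.toHom.map_adj h⟩

lemma image_nbr {n k : ℕ} (G : SimpleGraph (Fin n)) [DecidableRel G.Adj]
    (f : Fin (k+3) → Fin n) (hf : Function.Injective f)
    (h : ∀ i j, (cycleGraph (k+3)).Adj i j → G.Adj (f i) (f j)) (i : Fin (k+3)) :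
    ((cycleGraph (k+3)).neighborFinset i).image f ⊆ G.neighborFinset (f i) ∧
    (((cycleGraph (k+3)).neighborFinset i).image f).card = 2 := by
  constructor
  · intro x hx
    simp only [Finset.mem_image, mem_neighborFinset] at hx ⊢
    obtain ⟨j, hj, rfl⟩ := hx
    exact h _ _ hj
  · rw [Finset.card_image_of_injective _ hf, card_neighborFinset_eq_degree]
    exact cycleGraph_degree_three_le

lemma exists_three {n : ℕ} (G : SimpleGraph (Fin n)) [DecidableRel G.Adj]
    (hG : IsUnicyclic G) : ∃ a b c : Fin n, a ≠ b ∧ a ≠ c ∧ b ≠ c ∧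
      2 ≤ G.degree a ∧ 2 ≤ G.degree b ∧ 2 ≤ G.degree c := by
  obtain ⟨k, f, hf, h⟩ := exists_cycle_map G hG
  have hd : ∀ i, 2 ≤ G.degree (f i) := fun i => by
    have := image_nbr G f hf h i
    rw [← this.2, ← card_neighborFinset_eq_degree]
    exact Finset.card_le_card this.1
  refine ⟨f ⟨0, by omega⟩, f ⟨1, by omega⟩, f ⟨2, by omega⟩, ?_, ?_, ?_, hd _, hd _, hd _⟩ <;>
  · intro h
    have := hf h
    simp at this

lemma iso_cycle {n : ℕ} (G : SimpleGraph (Fin n)) [DecidableRel G.Adj]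
    (hG : IsUnicyclic G) (hd : ∀ u, G.degree u = 2) : Nonempty (G ≃g cycleGraph n) := by
  obtain ⟨k, f, hf, h⟩ := exists_cycle_map G hG
  have heq : ∀ i, ((cycleGraph (k+3)).neighborFinset i).image f = G.neighborFinset (f i) := by
    intro i
    have := image_nbr G f hf h i
    apply Finset.eq_of_subset_of_card_le this.1
    rw [this.2, card_neighborFinset_eq_degree, hd]
  have hstep : ∀ i v, G.Adj (f i) v → ∃ j, (cycleGraph (k+3)).Adj i j ∧ f j = v := by
    intro i v hv
    have : v ∈ G.neighborFinset (f i) := by simpa using hv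
    rw [← heq] at this
    simpa using this
  have hsurj : Function.Surjective f := by
    intro v
    obtain ⟨p⟩ := hG.1.preconnected (f 0) v
    have key : ∀ (u w : Fin n) (p : G.Walk u w), (∃ i, f i = u) → ∃ i, f i = w := by
      intro u w p
      induction p with
      | nil => exact id
      | cons hadj _ ih =>
        rintro ⟨i, rfl⟩
        obtain ⟨j, -, hj⟩ := hstep i _ hadj
        exact ih ⟨j, hj⟩
    exact key _ _ p ⟨0, rfl⟩
  have hbij : Function.Bijective f := ⟨hf, hsurj⟩
  have hcard := Fintype.card_of_bijective hbij
  simp only [Fintype.card_fin] at hcard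
  subst hcard
  refine ⟨RelIso.symm ⟨Equiv.ofBijective f hbij, ?_⟩⟩
  intro i j
  simp only [Equiv.ofBijective_apply]
  constructor
  · intro hij
    obtain ⟨j', hj', he⟩ := hstep i _ hij
    rw [← hf he]
    exact hj'
  · exact h i j

lemma exists_perm {n : ℕ} (a b c x y z : Fin n) (hab : a ≠ b) (hac : a ≠ c) (hbc : b ≠ c)
    (hxy : x ≠ y) (hxz : x ≠ z) (hyz : y ≠ z) :
    ∃ e : Fin n ≃ Fin n, e a = x ∧ e b = y ∧ e c = z := by
  obtain ⟨e1, h1⟩ : ∃ e : Fin n ≃ Fin n, e a = x := ⟨Equiv.swap a x, by simp⟩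
  obtain ⟨e2, h2, h2'⟩ : ∃ e : Fin n ≃ Fin n, e a = x ∧ e b = y := by
    refine ⟨e1.trans (Equiv.swap (e1 b) y), ?_, by simp⟩
    simp only [Equiv.trans_apply, h1]
    apply Equiv.swap_apply_of_ne_of_ne _ hxy
    rw [← h1]
    exact fun h => hab (e1.injective h)
  refine ⟨e2.trans (Equiv.swap (e2 c) z), ?_, ?_, by simp⟩
  · simp only [Equiv.trans_apply, h2]
    apply Equiv.swap_apply_of_ne_of_ne _ hxz
    rw [← h2]
    exact fun h => hac (e2.injective h)
  · simp only [Equiv.trans_apply, h2']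
    apply Equiv.swap_apply_of_ne_of_ne _ hyz
    rw [← h2']
    exact fun h => hbc (e2.injective h)

lemma unistar_adj {n : ℕ} (i j : Fin n) : (unicyclicStar n).Adj i j ↔ i ≠ j ∧
    (i.val = 0 ∨ j.val = 0 ∨ (i.val = 1 ∧ j.val = 2) ∨ (j.val = 1 ∧ i.val = 2)) := by
  simp only [unicyclicStar, fromRel_adj]
  tauto

lemma iso_star {n : ℕ} (hn : 4 ≤ n) (G : SimpleGraph (Fin n)) [DecidableRel G.Adj]
    (a b c : Fin n) (hab : a ≠ b) (hac : a ≠ c) (hbc : b ≠ c)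
    (ha : G.degree a = n - 1) (hb : G.degree b = 2) (hc : G.degree c = 2)
    (ho : ∀ u, u ≠ a → u ≠ b → u ≠ c → G.degree u = 1) :
    Nonempty (G ≃g unicyclicStar n) := by
  have hall : ∀ v, v ≠ a → G.Adj a v := by
    have h1 : G.neighborFinset a = Finset.univ.erase a := by
      apply Finset.eq_of_subset_of_card_le
      · intro x hx
        simp only [mem_neighborFinset] at hx
        simp [hx.ne']
      · rw [card_neighborFinset_eq_degree, ha]
        simp
    intro v hv
    have : v ∈ G.neighborFinset a := by rw [h1]; simp [hv]
    simpa using this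
  have hone : ∀ u, u ≠ a → u ≠ b → u ≠ c → ∀ v, G.Adj u v → v = a := by
    intro u h1 h2 h3 v hv
    have := ho u h1 h2 h3
    rw [degree_eq_one_iff_existsUnique_adj] at this
    exact this.unique hv (hall u h1).symm
  have hnb : ∀ v, G.Adj b v → v = a ∨ v = c := by
    intro v hv
    by_contra hcon
    push Not at hcon
    exact hab (hone v hcon.1 hv.ne' hcon.2 b hv.symm).symm
  have hnc : ∀ v, G.Adj c v → v = a ∨ v = b := by
    intro v hv
    by_contra hcon
    push Not at hcon
    exact hac (hone v hcon.1 hcon.2 hv.ne' c hv.symm).symm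
  have hbcadj : G.Adj b c := by
    by_contra hcon
    have h1 : G.neighborFinset b ⊆ {a} := by
      intro v hv
      simp only [mem_neighborFinset] at hv
      rcases hnb v hv with rfl | rfl
      · simp
      · exact absurd hv hcon
    have := Finset.card_le_card h1
    rw [card_neighborFinset_eq_degree, hb] at this
    simp at this
  have hadj : ∀ u v, G.Adj u v ↔ u ≠ v ∧ (u = a ∨ v = a ∨ (u = b ∧ v = c) ∨ (v = b ∧ u = c)) := by
    intro u v
    constructor
    · intro h
      refine ⟨h.ne, ?_⟩
      by_cases h1 : u = a
      · exact Or.inl h1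
      by_cases h2 : u = b
      · subst h2
        rcases hnb v h with h | h <;> simp [h]
      by_cases h3 : u = c
      · subst h3
        rcases hnc v h with h | h <;> simp [h]
      exact Or.inr (Or.inl (hone u h1 h2 h3 v h))
    · rintro ⟨hne, rfl | rfl | ⟨rfl, rfl⟩ | ⟨rfl, rfl⟩⟩
      · exact hall v hne.symm
      · exact (hall u hne).symm
      · exact hbcadj
      · exact hbcadj.symm
  obtain ⟨e, e0, e1, e2⟩ := exists_perm a b c ⟨0, by omega⟩ ⟨1, by omega⟩ ⟨2, by omega⟩ hab hac hbc
    (by simp) (by simp) (by simp)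
  have k0 : ∀ u, (e u).val = 0 ↔ u = a := by
    intro u; rw [← e.injective.eq_iff, e0, Fin.ext_iff]
  have k1 : ∀ u, (e u).val = 1 ↔ u = b := by
    intro u; rw [← e.injective.eq_iff, e1, Fin.ext_iff]
  have k2 : ∀ u, (e u).val = 2 ↔ u = c := by
    intro u; rw [← e.injective.eq_iff, e2, Fin.ext_iff]
  refine ⟨⟨e, ?_⟩⟩
  intro u v
  rw [unistar_adj, hadj, k0, k0, k1, k1, k2, k2, e.injective.ne_iff]

lemma sum_iso {n : ℕ} (G H : SimpleGraph (Fin n)) [DecidableRel G.Adj] [DecidableRel H.Adj]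
    (e : G ≃g H) (α : ℝ) :
    ∑ u : Fin n, (G.degree u : ℝ) ^ α = ∑ u : Fin n, (H.degree u : ℝ) ^ α := by
  rw [← Equiv.sum_comp e.toEquiv (fun u => (H.degree u : ℝ) ^ α)]
  apply Finset.sum_congr rfl
  intro u _
  have : H.degree (e.toEquiv u) = G.degree u := e.degree_eq u
  rw [this]

lemma sum_three {n : ℕ} (a b c : Fin n) (hab : a ≠ b) (hac : a ≠ c) (hbc : b ≠ c) (x y : ℝ) :
    ∑ u : Fin n, (if u = a ∨ u = b ∨ u = c then x else y) = 3 * x + ((n:ℝ) - 3) * y := by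
  have : ∀ u : Fin n, (if u = a ∨ u = b ∨ u = c then x else y) =
     y + ((if u = a then x - y else 0) + (if u = b then x - y else 0) + (if u = c then x - y else 0)) := by
    intro u
    by_cases h1 : u = a
    · subst h1; simp [hab, hac]
    by_cases h2 : u = b
    · subst h2; simp [hbc, h1]
    by_cases h3 : u = c
    · subst h3; simp [h1, h2]
    simp [h1, h2, h3]
  rw [Finset.sum_congr rfl (fun u _ => this u)]
  simp [Finset.sum_add_distrib]
  ring

lemma unistar_sum {n : ℕ} (hn : 4 ≤ n) [DecidableRel (unicyclicStar n).Adj] (α : ℝ) :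
    ∑ u : Fin n, ((unicyclicStar n).degree u : ℝ) ^ α
      = ((n : ℝ) - 1) ^ α + 2 ^ (α + 1) + (n : ℝ) - 3 := by
  obtain ⟨m, rfl⟩ := Nat.exists_eq_add_of_le' (show 3 ≤ n by omega)
  have v0 : ((0 : Fin (m+3)) : ℕ) = 0 := rfl
  have v1 : ((1 : Fin (m+3)) : ℕ) = 1 := Nat.mod_eq_of_lt (show 1 < m + 3 by omega)
  have v2 : ((2 : Fin (m+3)) : ℕ) = 2 := Nat.mod_eq_of_lt (show 2 < m + 3 by omega)
  have d0 : (unicyclicStar (m+3)).degree 0 = m + 2 := by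
    have : (unicyclicStar (m+3)).neighborFinset 0 = Finset.univ.erase 0 := by
      ext x
      simp [unistar_adj, eq_comm]
    rw [← card_neighborFinset_eq_degree, this]
    simp
  have d1 : (unicyclicStar (m+3)).degree 1 = 2 := by
    have : (unicyclicStar (m+3)).neighborFinset 1 = {0, 2} := by
      ext x
      simp only [mem_neighborFinset, unistar_adj, Finset.mem_insert, Finset.mem_singleton, Fin.ext_iff,
        ne_eq, v0, v1, v2]
      grind
    rw [← card_neighborFinset_eq_degree, this]
    rw [Finset.card_pair]
    simp only [ne_eq, Fin.ext_iff, v0, v1, v2]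
    omega
  have d2 : (unicyclicStar (m+3)).degree 2 = 2 := by
    have : (unicyclicStar (m+3)).neighborFinset 2 = {0, 1} := by
      ext x
      simp only [mem_neighborFinset, unistar_adj, Finset.mem_insert, Finset.mem_singleton, Fin.ext_iff,
        ne_eq, v0, v1, v2]
      grind
    rw [← card_neighborFinset_eq_degree, this]
    rw [Finset.card_pair]
    simp only [ne_eq, Fin.ext_iff, v0, v1, v2]
    omega
  have d3 : ∀ i : Fin m, (unicyclicStar (m+3)).degree i.succ.succ.succ = 1 := by
    intro i
    have : (unicyclicStar (m+3)).neighborFinset i.succ.succ.succ = {0} := by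
      ext x
      simp only [mem_neighborFinset, unistar_adj, Finset.mem_singleton, Fin.ext_iff,
        ne_eq, v0, Fin.val_succ]
      omega
    rw [← card_neighborFinset_eq_degree, this]
    simp
  rw [Fin.sum_univ_succ, Fin.sum_univ_succ, Fin.sum_univ_succ]
  have e1 : (Fin.succ 0 : Fin (m+3)) = 1 := rfl
  have e2 : (Fin.succ (Fin.succ 0) : Fin (m+3)) = 2 := rfl
  simp only [d3]
  rw [e2, e1, d0, d1, d2, Real.rpow_add_one (by norm_num)]
  simp
  ring_nf

lemma up_point (α : ℝ) (hα : 0 < α ∧ α < 1) (x : ℝ) (hx : 0 ≤ x) (hne : x ≠ 2) :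
    x ^ α < 2 ^ α + 2 ^ α * α / 2 * (x - 2) := by
  have h := rpow_one_add_lt_one_add_mul_self (s := x / 2 - 1) (by linarith)
    (fun h => hne (by linarith)) hα.1 hα.2
  rw [show 1 + (x / 2 - 1) = x / 2 by ring, Real.div_rpow hx (by norm_num)] at h
  have h2 : (0:ℝ) < 2 ^ α := by positivity
  rw [div_lt_iff₀ h2] at h
  linarith

/-- chord inequality -/
lemma chord (α : ℝ) (hα : 0 < α ∧ α < 1) (x y z : ℝ) (hx : 0 ≤ x) (hxy : x < y) (hyz : y < z) :
    x ^ α + (z ^ α - x ^ α) / (z - x) * (y - x) < y ^ α := by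
  have h := (Real.strictConcaveOn_rpow hα.1 hα.2).slope_anti_adjacent (x := x) (y := y) (z := z)
    hx (by simp; linarith) hxy hyz
  have hd := div_mul_cancel₀ (z ^ α - x ^ α) (show z - x ≠ 0 by linarith)
  have h1 : 0 < z - x := by linarith
  rw [div_lt_div_iff₀ (by linarith) (by linarith)] at h
  have : (z ^ α - x ^ α) / (z - x) * (y - x) < y ^ α - x ^ α := by
    rw [div_mul_eq_mul_div, div_lt_iff₀ h1]
    nlinarith
  linarith

theorem stmt7 {n : ℕ} (hn : 4 ≤ n) (G : SimpleGraph (Fin n)) [DecidableRel G.Adj]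
    (hG : IsUnicyclic G) (α : ℝ) (hα : 0 < α ∧ α < 1) :
    (((n : ℝ) - 1) ^ α + 2 ^ (α + 1) + (n : ℝ) - 3 ≤ ∑ u : Fin n, (G.degree u : ℝ) ^ α) ∧
    (∑ u : Fin n, (G.degree u : ℝ) ^ α ≤ (n : ℝ) * 2 ^ α) ∧
    ((∑ u : Fin n, (G.degree u : ℝ) ^ α = ((n : ℝ) - 1) ^ α + 2 ^ (α + 1) + (n : ℝ) - 3) ↔
      Nonempty (G ≃g unicyclicStar n)) ∧
    ((∑ u : Fin n, (G.degree u : ℝ) ^ α = (n : ℝ) * 2 ^ α) ↔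
      Nonempty (G ≃g SimpleGraph.cycleGraph n)) := by
  classical
  have hnR : (4:ℝ) ≤ n := by exact_mod_cast hn
  have hsumN : ∑ u : Fin n, G.degree u = 2 * n := by
    rw [sum_degrees_eq_twice_card_edges, hG.2]
  have hsum : ∑ u : Fin n, (G.degree u : ℝ) = 2 * n := by exact_mod_cast hsumN
  have hmax : ∀ u, G.degree u ≤ n - 1 := by
    intro u
    have := G.degree_lt_card_verts u
    simp only [Fintype.card_fin] at this
    omega
  have hmaxR : ∀ u, (G.degree u : ℝ) ≤ n - 1 := by
    intro u
    have h1 := hmax u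
    have : G.degree u + 1 ≤ n := by omega
    have : (G.degree u : ℝ) + 1 ≤ n := by exact_mod_cast this
    linarith
  have hpos : ∀ u, 1 ≤ G.degree u := by
    intro u
    have : Nontrivial (Fin n) := Fin.nontrivial_iff_two_le.mpr (by omega)
    exact hG.1.preconnected.degree_pos_of_nontrivial u
  -- upper bound
  have hupp : ∀ u, (G.degree u : ℝ) ^ α ≤ 2 ^ α + 2 ^ α * α / 2 * (G.degree u - 2) := by
    intro u
    by_cases h : (G.degree u : ℝ) = 2
    · rw [h]; simp
    · exact (up_point α hα _ (by positivity) h).le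
  have huppsum : ∑ u : Fin n, (2 ^ α + 2 ^ α * α / 2 * ((G.degree u : ℝ) - 2)) = n * 2 ^ α := by
    rw [Finset.sum_add_distrib, ← Finset.mul_sum, Finset.sum_sub_distrib, hsum]
    simp
    right; ring
  -- lower bound
  obtain ⟨a, b, c, hab, hac, hbc, ha, hb, hc⟩ := exists_three G hG
  set s : ℝ := (((n:ℝ) - 1) ^ α - 2 ^ α) / (((n:ℝ) - 1) - 2) with hs
  have hs1 : ∀ u, 2 ≤ G.degree u → (2:ℝ) ^ α + s * (G.degree u - 2) ≤ (G.degree u : ℝ) ^ α ∧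
      ((2:ℝ) ^ α + s * (G.degree u - 2) = (G.degree u : ℝ) ^ α →
        G.degree u = 2 ∨ G.degree u = n - 1) := by
    intro u hu
    by_cases h2 : G.degree u = 2
    · exact ⟨by rw [h2]; simp, fun _ => Or.inl h2⟩
    by_cases h3 : G.degree u = n - 1
    · refine ⟨?_, fun _ => Or.inr h3⟩
      have : (G.degree u : ℝ) = n - 1 := by rw [h3, Nat.cast_sub (by omega)]; simp
      rw [this, hs, div_mul_cancel₀ _ (by linarith)]
      linarith
    · have hm := hmax u
      have k1 : (2:ℝ) < G.degree u := by exact_mod_cast (show 2 < G.degree u by omega)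
      have k2 : (G.degree u : ℝ) < n - 1 := by
        have : ((G.degree u + 1 : ℕ) : ℝ) < n := by exact_mod_cast (show G.degree u + 1 < n by omega)
        push_cast at this
        linarith
      have := chord α hα 2 (G.degree u) (n - 1) (by norm_num) k1 k2
      exact ⟨this.le, fun h => absurd h this.ne⟩
  have hs2 : ∀ u, (1:ℝ) + s * (G.degree u - 1) ≤ (G.degree u : ℝ) ^ α ∧
      ((1:ℝ) + s * (G.degree u - 1) = (G.degree u : ℝ) ^ α → G.degree u = 1) := by
    intro u
    by_cases h1 : G.degree u = 1
    · exact ⟨by rw [h1]; simp, fun _ => h1⟩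
    · have hp := hpos u
      have hu : 2 ≤ G.degree u := by omega
      have k := (hs1 u hu).1
      have hsl : 1 + s < 2 ^ α := by
        have := (Real.strictConcaveOn_rpow hα.1 hα.2).slope_anti_adjacent (x := 1) (y := 2)
          (z := (n:ℝ) - 1) (by simp) (by simp; linarith) (by norm_num) (by linarith)
        rw [Real.one_rpow] at this
        have h21 : ((2:ℝ) ^ α - 1) / (2 - 1) = 2 ^ α - 1 := by norm_num
        rw [h21] at this
        linarith
      have : (1:ℝ) + s * (G.degree u - 1) < (G.degree u : ℝ) ^ α := by linarith
      exact ⟨this.le, fun h => absurd h this.ne⟩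
  set L : Fin n → ℝ := fun u => (if u = a ∨ u = b ∨ u = c then (2:ℝ) ^ α - s * 2 else 1 - s)
    + s * G.degree u with hL
  have hLle : ∀ u, L u ≤ (G.degree u : ℝ) ^ α := by
    intro u
    simp only [hL]
    split_ifs with h
    · have : 2 ≤ G.degree u := by rcases h with rfl | rfl | rfl <;> assumption
      have := (hs1 u this).1
      linarith
    · have := (hs2 u).1
      linarith
  have hLsum : ∑ u, L u = ((n : ℝ) - 1) ^ α + 2 ^ (α + 1) + (n : ℝ) - 3 := by
    simp only [hL]
    rw [Finset.sum_add_distrib, ← Finset.mul_sum, hsum, sum_three a b c hab hac hbc,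
      Real.rpow_add_one (by norm_num)]
    have : s * ((n:ℝ) - 1 - 2) = ((n:ℝ) - 1) ^ α - 2 ^ α := by
      rw [hs, div_mul_cancel₀ _ (by linarith)]
    linarith
  refine ⟨?_, ?_, ⟨?_, ?_⟩, ⟨?_, ?_⟩⟩
  · rw [← hLsum]
    exact Finset.sum_le_sum fun u _ => hLle u
  · rw [← huppsum]
    exact Finset.sum_le_sum fun u _ => hupp u
  · intro h
    rw [← hLsum] at h
    have heq := (Finset.sum_eq_sum_iff_of_le (fun u _ => hLle u)).1 h.symm
    have h1 : ∀ u, u ≠ a → u ≠ b → u ≠ c → G.degree u = 1 := by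
      intro u h1 h2 h3
      apply (hs2 u).2
      have := heq u (Finset.mem_univ _)
      simp only [hL, h1, h2, h3, or_self, if_false] at this
      linarith
    have h2 : ∀ u, (u = a ∨ u = b ∨ u = c) → G.degree u = 2 ∨ G.degree u = n - 1 := by
      intro u hu
      have hd : 2 ≤ G.degree u := by rcases hu with rfl | rfl | rfl <;> assumption
      apply (hs1 u hd).2
      have := heq u (Finset.mem_univ _)
      simp only [hL, hu, if_true] at this
      linarith
    have h3 : G.degree a + G.degree b + G.degree c = n + 3 := by
      have hz : ∑ u : Fin n, (G.degree u - 1 + 1) = 2 * n := by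
        rw [← hsumN]
        exact Finset.sum_congr rfl fun u _ => Nat.sub_add_cancel (hpos u)
      rw [Finset.sum_add_distrib] at hz
      have hsub : ∑ u ∈ ({a, b, c} : Finset (Fin n)), (G.degree u - 1)
          = ∑ u : Fin n, (G.degree u - 1) := by
        apply Finset.sum_subset (Finset.subset_univ _)
        intro u _ hu
        simp only [Finset.mem_insert, Finset.mem_singleton, not_or] at hu
        simp [h1 u hu.1 hu.2.1 hu.2.2]
      rw [← hsub, Finset.sum_insert (by simp [hab, hac]), Finset.sum_insert (by simp [hbc]),
        Finset.sum_singleton] at hz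
      simp at hz
      omega
    have ka := h2 a (by simp)
    have kb := h2 b (by simp)
    have kc := h2 c (by simp)
    have : (G.degree a = n - 1 ∧ G.degree b = 2 ∧ G.degree c = 2) ∨
      (G.degree b = n - 1 ∧ G.degree a = 2 ∧ G.degree c = 2) ∨
      (G.degree c = n - 1 ∧ G.degree a = 2 ∧ G.degree b = 2) := by omega
    rcases this with ⟨x, y, z⟩ | ⟨x, y, z⟩ | ⟨x, y, z⟩
    · exact iso_star hn G a b c hab hac hbc x y z h1
    · exact iso_star hn G b a c hab.symm hbc hac x y z (fun u p q r => h1 u q p r)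
    · exact iso_star hn G c a b hac.symm hbc.symm hab x y z (fun u p q r => h1 u q r p)
  · rintro ⟨e⟩
    rw [sum_iso G _ e, unistar_sum hn]
  · intro h
    rw [← huppsum] at h
    have heq := (Finset.sum_eq_sum_iff_of_le (fun u _ => hupp u)).1 h
    apply iso_cycle G hG
    intro u
    by_contra hne
    exact (up_point α hα (G.degree u) (by positivity) (by exact_mod_cast hne)).ne
      (heq u (Finset.mem_univ _))
  · rintro ⟨e⟩
    rw [sum_iso G _ e]
    obtain ⟨m, rfl⟩ := Nat.exists_eq_add_of_le' (show 3 ≤ n by omega)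
    have : ∀ u, (cycleGraph (m+3)).degree u = 2 := fun u => by
      convert cycleGraph_degree_three_le (v := u)
    simp [this]
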